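/- Let W ∈ ℝ^{d×d} be symmetric positive definite, c ∈ ℝ^d, let 𝒱 ⊂ ℝ^d be a finite set not containing 0, and let 𝒳 be the convex hull of 𝒱. Set Θ = {θ ∈ ℝ^d : ‖θ − c‖_W ≤ 1}. If x* ∈ 𝒱 maximizes x ↦ xᵀc + ‖x‖_{W⁻¹} over 𝒱, then x* also maximizes this function over all of 𝒳, and the pair (x*, θ*) with θ* = c + W⁻¹x*/‖x*‖_{W⁻¹} maximizes (x, θ) ↦ xᵀθ over 𝒳 × Θ. -/

import Mathlib

open Matrix Set

/-- `mNorm M z = √(zᵀ M z)`. -/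
noncomputable def mNorm {d : ℕ} (M : Matrix (Fin d) (Fin d) ℝ) (z : Fin d → ℝ) : ℝ :=
  Real.sqrt (z ⬝ᵥ M *ᵥ z)

section MNorm

variable {d : ℕ} {M W : Matrix (Fin d) (Fin d) ℝ}

lemma mNorm_nonneg (M : Matrix (Fin d) (Fin d) ℝ) (z : Fin d → ℝ) : 0 ≤ mNorm M z :=
  Real.sqrt_nonneg _

lemma mNorm_sq (hM : M.PosSemidef) (z : Fin d → ℝ) : mNorm M z ^ 2 = z ⬝ᵥ M *ᵥ z :=
  Real.sq_sqrt (by simpa using hM.dotProduct_mulVec_nonneg z)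

lemma mNorm_pos (hM : M.PosDef) {z : Fin d → ℝ} (hz : z ≠ 0) : 0 < mNorm M z :=
  Real.sqrt_pos.2 (by simpa using hM.dotProduct_mulVec_pos hz)

lemma mNorm_smul (M : Matrix (Fin d) (Fin d) ℝ) {a : ℝ} (ha : 0 ≤ a) (z : Fin d → ℝ) :
    mNorm M (a • z) = a * mNorm M z := by
  simp only [mNorm, mulVec_smul, smul_dotProduct, dotProduct_smul, smul_eq_mul, ← mul_assoc]
  rw [Real.sqrt_mul (mul_self_nonneg a), Real.sqrt_mul_self ha]

lemma dotProduct_mulVec_symm (hM : M.IsHermitian) (x y : Fin d → ℝ) :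
    y ⬝ᵥ M *ᵥ x = x ⬝ᵥ M *ᵥ y := by
  rw [dotProduct_comm, dotProduct_mulVec, ← mulVec_transpose,
    ← conjTranspose_eq_transpose_of_trivial, hM.eq]

/-- Cauchy–Schwarz inequality for a positive semidefinite matrix. -/
lemma dotProduct_mulVec_le_mNorm_mul_mNorm (hM : M.PosSemidef) (x y : Fin d → ℝ) :
    x ⬝ᵥ M *ᵥ y ≤ mNorm M x * mNorm M y := by
  have key : ∀ t : ℝ, 0 ≤ (y ⬝ᵥ M *ᵥ y) * (t * t) + 2 * (x ⬝ᵥ M *ᵥ y) * t + x ⬝ᵥ M *ᵥ x := by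
    intro t
    have h := hM.dotProduct_mulVec_nonneg (x + t • y)
    simp only [star_trivial, mulVec_add, mulVec_smul, add_dotProduct, dotProduct_add,
      smul_dotProduct, dotProduct_smul, smul_eq_mul, dotProduct_mulVec_symm hM.1 x y] at h
    linarith
  have hdisc := discrim_le_zero key
  rw [discrim, ← mNorm_sq hM, ← mNorm_sq hM] at hdisc
  refine (abs_le_of_sq_le_sq' ?_ (mul_nonneg (mNorm_nonneg M x) (mNorm_nonneg M y))).2
  linarith [mul_pow (mNorm M x) (mNorm M y) 2]

lemma mNorm_add_le (hM : M.PosSemidef) (x y : Fin d → ℝ) :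
    mNorm M (x + y) ≤ mNorm M x + mNorm M y := by
  refine (abs_le_of_sq_le_sq' ?_ (add_nonneg (mNorm_nonneg M x) (mNorm_nonneg M y))).2
  have h := dotProduct_mulVec_le_mNorm_mul_mNorm hM x y
  rw [mNorm_sq hM, add_sq, mNorm_sq hM, mNorm_sq hM]
  simp only [mulVec_add, add_dotProduct, dotProduct_add, dotProduct_mulVec_symm hM.1 x y]
  linarith

lemma convexOn_dotProduct_add_mNorm (hM : M.PosSemidef) (c : Fin d → ℝ) :
    ConvexOn ℝ univ fun x => x ⬝ᵥ c + mNorm M x := by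
  refine ⟨convex_univ, fun x _ y _ a b ha hb _ => ?_⟩
  have h := mNorm_add_le hM (a • x) (b • y)
  rw [mNorm_smul M ha, mNorm_smul M hb] at h
  simp only [add_dotProduct, smul_dotProduct, smul_eq_mul]
  linarith

lemma mulVec_inv_mulVec (hW : W.PosDef) (x : Fin d → ℝ) : W *ᵥ W⁻¹ *ᵥ x = x := by
  rw [mulVec_mulVec, mul_nonsing_inv _ ((isUnit_iff_isUnit_det W).1 hW.isUnit), one_mulVec]

lemma mNorm_inv_mulVec (hW : W.PosDef) (x : Fin d → ℝ) : mNorm W (W⁻¹ *ᵥ x) = mNorm W⁻¹ x := by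
  rw [mNorm, mNorm, mulVec_inv_mulVec hW, dotProduct_comm]

lemma dotProduct_le_mNorm_inv_mul_mNorm (hW : W.PosDef) (x y : Fin d → ℝ) :
    x ⬝ᵥ y ≤ mNorm W⁻¹ x * mNorm W y := by
  have h := dotProduct_mulVec_le_mNorm_mul_mNorm hW.posSemidef (W⁻¹ *ᵥ x) y
  rwa [mNorm_inv_mulVec hW, dotProduct_mulVec_symm hW.1, mulVec_inv_mulVec hW,
    dotProduct_comm] at h

end MNorm

/-- if `𝒳` is the convex hull of a finite vertex set `𝒱` (with `0 ∉ 𝒱`)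
and `x* ∈ 𝒱` maximizes `x ↦ xᵀc + ‖x‖_{W⁻¹}` over `𝒱`, then `x*` maximizes this
function over all of `𝒳`, and `(x*, θ*)` with `θ* = c + W⁻¹x*/‖x*‖_{W⁻¹}`
maximizes `(x,θ) ↦ xᵀθ` over `𝒳 × Θ` where `Θ = {θ : ‖θ - c‖_W ≤ 1}`. -/
theorem stmt2 {d : ℕ} (W : Matrix (Fin d) (Fin d) ℝ) (hW : W.PosDef)
    (c : Fin d → ℝ) (V : Finset (Fin d → ℝ)) (h0 : (0 : Fin d → ℝ) ∉ V)
    (xs : Fin d → ℝ) (hxs : xs ∈ V)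
    (hmax : ∀ v ∈ V, v ⬝ᵥ c + mNorm W⁻¹ v ≤ xs ⬝ᵥ c + mNorm W⁻¹ xs) :
    (∀ x ∈ convexHull ℝ (V : Set (Fin d → ℝ)),
        x ⬝ᵥ c + mNorm W⁻¹ x ≤ xs ⬝ᵥ c + mNorm W⁻¹ xs) ∧
    (c + (mNorm W⁻¹ xs)⁻¹ • (W⁻¹ *ᵥ xs)) ∈ {θ : Fin d → ℝ | mNorm W (θ - c) ≤ 1} ∧
    ∀ x ∈ convexHull ℝ (V : Set (Fin d → ℝ)),
      ∀ θ ∈ {θ : Fin d → ℝ | mNorm W (θ - c) ≤ 1},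
        x ⬝ᵥ θ ≤ xs ⬝ᵥ (c + (mNorm W⁻¹ xs)⁻¹ • (W⁻¹ *ᵥ xs)) := by
  have hWi : W⁻¹.PosDef := hW.inv
  have hpos : 0 < mNorm W⁻¹ xs := mNorm_pos hWi (ne_of_mem_of_not_mem hxs h0)
  have hhull : ∀ x ∈ convexHull ℝ (V : Set (Fin d → ℝ)),
      x ⬝ᵥ c + mNorm W⁻¹ x ≤ xs ⬝ᵥ c + mNorm W⁻¹ xs := fun x hx =>
    (convexHull_min (t := {x ∈ univ | x ⬝ᵥ c + mNorm W⁻¹ x ≤ xs ⬝ᵥ c + mNorm W⁻¹ xs})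
      (fun v hv => ⟨mem_univ v, hmax v hv⟩)
      ((convexOn_dotProduct_add_mNorm hWi.posSemidef c).convex_le _) hx).2
  refine ⟨hhull, ?_, fun x hx θ hθ => ?_⟩
  · rw [mem_ofPred_eq, add_sub_cancel_left, mNorm_smul W (inv_nonneg.2 hpos.le),
      mNorm_inv_mulVec hW, inv_mul_cancel₀ hpos.ne']
  · calc x ⬝ᵥ θ = x ⬝ᵥ c + x ⬝ᵥ (θ - c) := by rw [dotProduct_sub]; ring
      _ ≤ x ⬝ᵥ c + mNorm W⁻¹ x := by
        gcongr
        exact (dotProduct_le_mNorm_inv_mul_mNorm hW x _).trans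
          (mul_le_of_le_one_right (mNorm_nonneg _ _) hθ)
      _ ≤ xs ⬝ᵥ c + mNorm W⁻¹ xs := hhull x hx
      _ = xs ⬝ᵥ (c + (mNorm W⁻¹ xs)⁻¹ • (W⁻¹ *ᵥ xs)) := by
        rw [dotProduct_add, dotProduct_smul, ← mNorm_sq hWi.posSemidef, smul_eq_mul]
        field_simp
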